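/- (Numerical zig-zag lemma.) Let 𝔠 be a left-exact ranked category with kernels, and let an ε-additive sequence of chain complexes be given, with rows A, B, C. Let (e_k)_{k≥0} be the sequence h_•^0(A), h_•^0(B), h_•^0(C), h_•^1(A), h_•^1(B), h_•^1(C), h_•^2(A), …. Then for all k ≥ 0, Σ_{j=0}^{k} (−1)^j e_{k−j} ≥ −(k+1)ε. -/

import Mathlib

open CategoryTheory CategoryTheory.Limits

/-- A left-exact rank function on a category with kernels. -/
structure LeftExactRank (𝔠 : Type*) [Category 𝔠] [HasZeroMorphisms 𝔠] [HasKernels 𝔠] where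
  rk : ∀ {X Y : 𝔠}, (X ⟶ Y) → ℝ
  rk_comp_le_left : ∀ {X Y Z : 𝔠} (f : X ⟶ Y) (g : Y ⟶ Z), rk (f ≫ g) ≤ rk f
  rk_comp_le_right : ∀ {X Y Z : 𝔠} (f : X ⟶ Y) (g : Y ⟶ Z), rk (f ≫ g) ≤ rk g
  rk_eq : ∀ {X Y : 𝔠} (f : X ⟶ Y), rk f = rk (𝟙 X) - rk (𝟙 (kernel f))

namespace LeftExactRank

variable {𝔠 : Type*} [Category 𝔠] [HasZeroMorphisms 𝔠] [HasKernels 𝔠] (R : LeftExactRank 𝔠)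

/-- The length of an object is the rank of its identity. -/
def len (X : 𝔠) : ℝ := R.rk (𝟙 X)

/-- The nullity of a morphism is the length of its kernel. -/
noncomputable def nul {X Y : 𝔠} (f : X ⟶ Y) : ℝ := R.len (kernel f)

theorem rk_add_nul {X Y : 𝔠} (f : X ⟶ Y) : R.rk f + R.nul f = R.len X := by
  have := R.rk_eq f
  simp only [nul, len]
  linarith

theorem rk_le_len_left {X Y : 𝔠} (f : X ⟶ Y) : R.rk f ≤ R.len X := by
  simpa [len] using R.rk_comp_le_left (𝟙 X) f

theorem rk_le_len_right {X Y : 𝔠} (f : X ⟶ Y) : R.rk f ≤ R.len Y := by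
  simpa [len] using R.rk_comp_le_right f (𝟙 Y)

theorem rk_zero (X Y : 𝔠) : R.rk (0 : X ⟶ Y) = 0 := by
  let l : X ⟶ kernel (0 : X ⟶ Y) := kernel.lift 0 (𝟙 X) (by simp)
  have hl : l ≫ kernel.ι _ = 𝟙 X := kernel.lift_ι _ _ _
  have hl' : kernel.ι _ ≫ l = 𝟙 _ := by
    rw [← cancel_mono (kernel.ι (0 : X ⟶ Y)), Category.assoc, hl]
    simp
  have h : R.len X ≤ R.nul (0 : X ⟶ Y) := by
    rw [len, ← hl]
    exact (R.rk_comp_le_left _ _).trans (R.rk_le_len_right _)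
  have h' : R.nul (0 : X ⟶ Y) ≤ R.len X := by
    rw [nul, len, ← hl']
    exact (R.rk_comp_le_left _ _).trans (R.rk_le_len_right _)
  linarith [R.rk_add_nul (0 : X ⟶ Y)]

theorem nul_of_mono {X Y : 𝔠} (f : X ⟶ Y) [Mono f] : R.nul f = 0 := by
  have h : 𝟙 (kernel f) = 0 := by
    rw [← cancel_mono (kernel.ι f), ← cancel_mono f]
    simp
  rw [nul, len, h, rk_zero]

theorem len_le_of_mono {X Y : 𝔠} (f : X ⟶ Y) [Mono f] : R.len X ≤ R.len Y := by
  linarith [R.rk_add_nul f, R.nul_of_mono f, R.rk_le_len_right f]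

theorem nul_comp_le {X Y Z : 𝔠} (f : X ⟶ Y) (g : Y ⟶ Z) :
    R.nul (f ≫ g) ≤ R.nul f + R.nul g := by
  let i := kernel.ι (f ≫ g)
  have hfac : R.rk (i ≫ f) ≤ R.nul g := by
    have h := R.rk_comp_le_left (kernel.lift g (i ≫ f) (by simp [i])) (kernel.ι g)
    rw [kernel.lift_ι] at h
    exact h.trans (R.rk_le_len_right _)
  let m : kernel (i ≫ f) ⟶ kernel f := kernel.lift f (kernel.ι (i ≫ f) ≫ i) (by simp)
  have hm : m ≫ kernel.ι f = kernel.ι (i ≫ f) ≫ i := kernel.lift_ι _ _ _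
  have : Mono (m ≫ kernel.ι f) := hm ▸ mono_comp _ _
  have : Mono m := mono_of_mono m (kernel.ι f)
  have h1 : R.nul (i ≫ f) ≤ R.nul f := R.len_le_of_mono m
  have h2 : R.rk (i ≫ f) + R.nul (i ≫ f) = R.nul (f ≫ g) := R.rk_add_nul _
  linarith

theorem rk_le_rk_comp_add_nul {X Y Z : 𝔠} (f : X ⟶ Y) (g : Y ⟶ Z) :
    R.rk f ≤ R.rk (f ≫ g) + R.nul g := by
  linarith [R.nul_comp_le f g, R.rk_add_nul f, R.rk_add_nul (f ≫ g)]

theorem nul_eq_len_of_isLimit {X Y Z : 𝔠} {f : X ⟶ Y} {g : Y ⟶ Z} (w : f ≫ g = 0)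
    (h : IsLimit (KernelFork.ofι f w)) : R.nul g = R.len X := by
  let i : X ≅ kernel g := IsLimit.conePointUniqueUpToIso h (limit.isLimit (parallelPair g 0))
  exact le_antisymm (R.len_le_of_mono i.inv) (R.len_le_of_mono i.hom)

theorem nul_kernel_ι_comp {A B C A' B' : 𝔠} {a : A ⟶ A'} {b : B ⟶ B'} {f : A ⟶ B}
    {f' : A' ⟶ B'} {g : B ⟶ C} [Mono f'] (comm : f ≫ b = a ≫ f') (w : f ≫ g = 0)
    (h : IsLimit (KernelFork.ofι f w)) : R.nul (kernel.ι b ≫ g) = R.nul a := by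
  have hf : Mono f := mono_of_isLimit_fork h
  apply le_antisymm
  · obtain ⟨l, hl⟩ := KernelFork.IsLimit.lift' h (kernel.ι (kernel.ι b ≫ g) ≫ kernel.ι b)
      (by simp)
    replace hl : l ≫ f = kernel.ι (kernel.ι b ≫ g) ≫ kernel.ι b := hl
    have hla : l ≫ a = 0 := by
      rw [← cancel_mono f', Category.assoc, ← comm, reassoc_of% hl]
      simp
    have : Mono (l ≫ f) := hl ▸ mono_comp _ _
    have : Mono l := mono_of_mono l f
    have : Mono (kernel.lift a l hla ≫ kernel.ι a) := by rwa [kernel.lift_ι]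
    have : Mono (kernel.lift a l hla) := mono_of_mono _ (kernel.ι a)
    exact R.len_le_of_mono (kernel.lift a l hla)
  · let l : kernel a ⟶ kernel b := kernel.lift b (kernel.ι a ≫ f) (by simp [comm])
    have hl : l ≫ kernel.ι b = kernel.ι a ≫ f := kernel.lift_ι _ _ _
    let m : kernel a ⟶ kernel (kernel.ι b ≫ g) := kernel.lift _ l (by simp [reassoc_of% hl, w])
    have hm : m ≫ kernel.ι (kernel.ι b ≫ g) = l := kernel.lift_ι _ _ _
    have : Mono (l ≫ kernel.ι b) := hl ▸ mono_comp _ _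
    have : Mono l := mono_of_mono l (kernel.ι b)
    have : Mono (m ≫ kernel.ι (kernel.ι b ≫ g)) := hm ▸ this
    have : Mono m := mono_of_mono m (kernel.ι _)
    exact R.len_le_of_mono m

theorem nul_le_nul_add_nul {A B C A' B' C' : 𝔠} {a : A ⟶ A'} {b : B ⟶ B'} {c : C ⟶ C'}
    {f : A ⟶ B} {f' : A' ⟶ B'} {g : B ⟶ C} {g' : B' ⟶ C'} [Mono f']
    (commf : f ≫ b = a ≫ f') (commg : g ≫ c = b ≫ g') (w : f ≫ g = 0)
    (h : IsLimit (KernelFork.ofι f w)) : R.nul b ≤ R.nul a + R.nul c := by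
  have h1 := R.rk_comp_le_left (kernel.lift c (kernel.ι b ≫ g) (by simp [commg])) (kernel.ι c)
  rw [kernel.lift_ι] at h1
  have h2 : R.rk (kernel.ι b ≫ g) ≤ R.nul c := h1.trans (R.rk_le_len_right _)
  have h3 : R.rk (kernel.ι b ≫ g) + R.nul (kernel.ι b ≫ g) = R.nul b := R.rk_add_nul _
  linarith [R.nul_kernel_ι_comp commf w h]

theorem rk_add_nul_le_nul_add {A B C A' B' C' A'' B'' : 𝔠} {a' : A' ⟶ A''} {b : B ⟶ B'}
    {b' : B' ⟶ B''} {c : C ⟶ C'} {f : A ⟶ B} {f' : A' ⟶ B'} {f'' : A'' ⟶ B''} {g : B ⟶ C}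
    {g' : B' ⟶ C'} [Mono f''] (hb : b ≫ b' = 0) (commf : f' ≫ b' = a' ≫ f'')
    (commg : g ≫ c = b ≫ g') (w : f ≫ g = 0) (h : IsLimit (KernelFork.ofι f w))
    (w' : f' ≫ g' = 0) (h' : IsLimit (KernelFork.ofι f' w')) :
    R.rk c + R.nul a' ≤ R.nul b' + (R.len C - R.len B + R.len A) := by
  have h1 := R.rk_comp_le_right (kernel.lift b' b hb) (kernel.ι b' ≫ g')
  rw [kernel.lift_ι_assoc, ← commg] at h1
  have h2 : R.rk (kernel.ι b' ≫ g') + R.nul (kernel.ι b' ≫ g') = R.nul b' := R.rk_add_nul _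
  linarith [R.nul_kernel_ι_comp commf w' h', R.nul_comp_le g c, R.nul_eq_len_of_isLimit w h,
    R.rk_add_nul c, R.rk_add_nul (g ≫ c)]

theorem rk_le_rk_add_nul {B C A' B' C' A'' B'' : 𝔠} {a' : A' ⟶ A''} {b : B ⟶ B'}
    {b' : B' ⟶ B''} {c : C ⟶ C'} {f' : A' ⟶ B'} {f'' : A'' ⟶ B''} {g : B ⟶ C}
    {g' : B' ⟶ C'} [Mono f''] (hb : b ≫ b' = 0) (commf : f' ≫ b' = a' ≫ f'')
    (commg : g ≫ c = b ≫ g') (w' : f' ≫ g' = 0) (h' : IsLimit (KernelFork.ofι f' w')) :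
    R.rk b ≤ R.rk c + R.nul a' := by
  have h1 := R.rk_le_rk_comp_add_nul (kernel.lift b' b hb) (kernel.ι b' ≫ g')
  rw [kernel.lift_ι_assoc, ← commg, R.nul_kernel_ι_comp commf w' h'] at h1
  have h2 := R.rk_comp_le_left (kernel.lift b' b hb) (kernel.ι b')
  have h3 := R.rk_comp_le_right g c
  rw [kernel.lift_ι] at h2
  linarith

end LeftExactRank

theorem alternating_sum_succ (e : ℕ → ℝ) (k : ℕ) :
    ∑ j ∈ Finset.range (k + 1 + 1), (-1 : ℝ) ^ j * e (k + 1 - j) =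
      e (k + 1) - ∑ j ∈ Finset.range (k + 1), (-1 : ℝ) ^ j * e (k - j) := by
  rw [Finset.sum_range_succ', add_comm, sub_eq_add_neg, ← Finset.sum_neg_distrib]
  simp [pow_succ]

/-- The numerical zig-zag lemma.  Let `𝔠` be a left-exact ranked category with kernels:
`rk` is a function from morphisms to nonnegative reals with `rk (f ≫ g) ≤ rk f`,
`rk (f ≫ g) ≤ rk g`, writing `ℓ(A) = rk (𝟙 A)` and `nul f = ℓ(Ker f)`, left-exactness says
`rk f = ℓ(A) - nul f` for every `f : A ⟶ B`.  Given an `ε`-additive sequence of chain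
complexes with rows `A`, `B`, `C` (each starting at a zero object), vertical maps
`f k : A k ⟶ B k` a kernel of `g k : B k ⟶ C k`, each column `ε`-additive
(`ℓ(C k) - ℓ(B k) + ℓ(A k) ≤ ε`), and `e` the interleaved sequence
`h•⁰(A), h•⁰(B), h•⁰(C), h•¹(A), …` where `h•ᵏ = nul(a (k+1)) - rk (a k)`, we have
`∑_{j=0}^{k} (-1)^j e_{k-j} ≥ -(k+1) ε`. -/
theorem stmt4 {𝔠 : Type*} [Category 𝔠] [HasZeroObject 𝔠] [HasZeroMorphisms 𝔠] [HasKernels 𝔠]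
    (rk : ∀ {X Y : 𝔠}, (X ⟶ Y) → ℝ)
    (rk_nonneg : ∀ {X Y : 𝔠} (f : X ⟶ Y), 0 ≤ rk f)
    (rk_comp_le_left : ∀ {X Y Z : 𝔠} (f : X ⟶ Y) (g : Y ⟶ Z), rk (f ≫ g) ≤ rk f)
    (rk_comp_le_right : ∀ {X Y Z : 𝔠} (f : X ⟶ Y) (g : Y ⟶ Z), rk (f ≫ g) ≤ rk g)
    (rk_leftExact : ∀ {X Y : 𝔠} (f : X ⟶ Y), rk f = rk (𝟙 X) - rk (𝟙 (kernel f)))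
    (ε : ℝ)
    (A B C : ℕ → 𝔠)
    (a : ∀ k, A k ⟶ A (k + 1)) (b : ∀ k, B k ⟶ B (k + 1)) (c : ∀ k, C k ⟶ C (k + 1))
    (hA0 : IsZero (A 0)) (hB0 : IsZero (B 0)) (hC0 : IsZero (C 0))
    (ha : ∀ k, a k ≫ a (k + 1) = 0) (hb : ∀ k, b k ≫ b (k + 1) = 0)
    (hc : ∀ k, c k ≫ c (k + 1) = 0)
    (f : ∀ k, A k ⟶ B k) (g : ∀ k, B k ⟶ C k)
    (hcommf : ∀ k, f k ≫ b k = a k ≫ f (k + 1))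
    (hcommg : ∀ k, g k ≫ c k = b k ≫ g (k + 1))
    (hfg : ∀ k, f k ≫ g k = 0)
    (hker : ∀ k, Nonempty (IsLimit (KernelFork.ofι (f k) (hfg k))))
    (hadd : ∀ k, rk (𝟙 (C k)) - rk (𝟙 (B k)) + rk (𝟙 (A k)) ≤ ε)
    (e : ℕ → ℝ)
    (he0 : ∀ k, e (3 * k) = rk (𝟙 (kernel (a (k + 1)))) - rk (a k))
    (he1 : ∀ k, e (3 * k + 1) = rk (𝟙 (kernel (b (k + 1)))) - rk (b k))
    (he2 : ∀ k, e (3 * k + 2) = rk (𝟙 (kernel (c (k + 1)))) - rk (c k)) :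
    ∀ k : ℕ, -((k : ℝ) + 1) * ε ≤ ∑ j ∈ Finset.range (k + 1), (-1 : ℝ) ^ j * e (k - j) := by
  let R : LeftExactRank 𝔠 := ⟨rk, rk_comp_le_left, rk_comp_le_right, rk_leftExact⟩
  have hmono (k) : Mono (f k) := mono_of_isLimit_fork (hker k).some
  have hD (k) : 0 ≤ R.len (C k) - R.len (B k) + R.len (A k) := by
    linarith [R.nul_eq_len_of_isLimit (hfg k) (hker k).some, R.rk_add_nul (g k),
      R.rk_le_len_right (g k)]
  replace hadd (k) : R.len (C k) - R.len (B k) + R.len (A k) ≤ ε := hadd k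
  have hε : 0 ≤ ε := (hD 0).trans (hadd 0)
  replace he0 (k) : e (3 * k) = R.nul (a (k + 1)) - R.rk (a k) := he0 k
  replace he1 (k) : e (3 * k + 1) = R.nul (b (k + 1)) - R.rk (b k) := he1 k
  replace he2 (k) : e (3 * k + 2) = R.nul (c (k + 1)) - R.rk (c k) := he2 k
  have rk_src {X Y : 𝔠} (hX : IsZero X) (u : X ⟶ Y) : R.rk u = 0 := by
    rw [hX.eq_of_src u 0, R.rk_zero]
  let T (k : ℕ) : ℝ := ∑ j ∈ Finset.range (k + 1), (-1 : ℝ) ^ j * e (k - j)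
  have hT (k) : T (k + 1) = e (k + 1) - T k := alternating_sum_succ e k
  have hT1 (k) : T (3 * k + 1) = R.nul (b (k + 1)) - R.rk (b k) - T (3 * k) := by
    rw [hT, he1]
  have hT2 (k) : T (3 * k + 2) = R.nul (c (k + 1)) - R.rk (c k) - T (3 * k + 1) := by
    rw [hT (3 * k + 1), he2]
  have hT3 (k) : T (3 * (k + 1)) =
      R.nul (a (k + 1 + 1)) - R.rk (a (k + 1)) - T (3 * k + 2) := by
    rw [← he0]
    exact hT (3 * k + 2)
  have inv (k : ℕ) :
      |T (3 * k) - (R.nul (a (k + 1)) + R.rk (c k) - R.rk (b k))| ≤ k * ε := by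
    induction k with
    | zero =>
      have : T 0 = e 0 := by simp [T]
      rw [mul_zero, this, ← mul_zero 3, he0, rk_src hA0, rk_src hB0, rk_src hC0]
      simp
    | succ k ih =>
      rw [abs_le] at ih ⊢
      push_cast
      have := R.rk_add_nul (a (k + 1))
      have := R.rk_add_nul (b (k + 1))
      have := R.rk_add_nul (c (k + 1))
      constructor <;> linarith [hT1 k, hT2 k, hT3 k, hD (k + 1), hadd (k + 1)]
  intro k
  change _ ≤ T k
  obtain ⟨m, hm⟩ : ∃ m, k = 3 * m ∨ k = 3 * m + 1 ∨ k = 3 * m + 2 := ⟨k / 3, by omega⟩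
  have hmε : 0 ≤ (m : ℝ) * ε := by positivity
  have := abs_le.mp (inv m)
  rcases hm with rfl | rfl | rfl
  · have := R.rk_le_rk_add_nul (hb m) (hcommf (m + 1)) (hcommg m) (hfg _) (hker (m + 1)).some
    push_cast
    linarith
  · have := R.rk_add_nul_le_nul_add (hb m) (hcommf (m + 1)) (hcommg m) (hfg m) (hker m).some
      (hfg _) (hker (m + 1)).some
    push_cast
    linarith [hT1 m, hadd m]
  · have := R.nul_le_nul_add_nul (hcommf (m + 1)) (hcommg (m + 1)) (hfg _) (hker (m + 1)).some
    push_cast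
    linarith [hT1 m, hT2 m]
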